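/- arXiv:2602.13097 — 6 statements merged into one kernel-verified Lean document; each statement's English description precedes it below -/
import Mathlib

section
/- Let π : G → B be a partial representation of a group G on a unital associative k-algebra B and set ε_g := π(g)π(g⁻¹). Then for any n ≥ 1 and any g_1, …, g_n ∈ G one has π(g_1)π(g_2)⋯π(g_n) = ε_{g_1} ε_{g_1 g_2} ⋯ ε_{g_1 g_2 ⋯ g_n} π(g_1 g_2 ⋯ g_n). -/
open scoped Pointwise

/-- A partial representation of a group `G` on a unital (`k`-)algebra `B`. -/
def IsPartialRep {G B : Type*} [Group G] [Monoid B] (π : G → B) : Prop :=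
  π 1 = 1 ∧
  (∀ g h : G, π g * π h * π h⁻¹ = π (g * h) * π h⁻¹) ∧
  (∀ g h : G, π g⁻¹ * π g * π h = π g⁻¹ * π (g * h))

/-- The defining relations of the partial group algebra. -/
inductive ParRel (k G : Type*) [CommSemiring k] [Group G] :
    FreeAlgebra k G → FreeAlgebra k G → Prop
  | one : ParRel k G (FreeAlgebra.ι k (1 : G)) 1
  | pr2 (g h : G) : ParRel k G
      (FreeAlgebra.ι k g * FreeAlgebra.ι k h * FreeAlgebra.ι k h⁻¹)
      (FreeAlgebra.ι k (g * h) * FreeAlgebra.ι k h⁻¹)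
  | pr3 (g h : G) : ParRel k G
      (FreeAlgebra.ι k g⁻¹ * FreeAlgebra.ι k g * FreeAlgebra.ι k h)
      (FreeAlgebra.ι k g⁻¹ * FreeAlgebra.ι k (g * h))

/-- The partial group algebra `k_par G`. -/
abbrev ParAlg (k G : Type*) [CommSemiring k] [Group G] := RingQuot (ParRel k G)

/-- The generator `[g]` of the partial group algebra. -/
noncomputable def parGen (k : Type*) {G : Type*} [CommSemiring k] [Group G] (g : G) :
    ParAlg k G :=
  RingQuot.mkAlgHom k (ParRel k G) (FreeAlgebra.ι k g)

/-- The idempotent `P_X = (∏_{r ∈ X} ε_r)·(∏_{s ∉ X} (1 - ε_s))`, where `ε_g = π(g)π(g⁻¹)`. -/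
noncomputable def parP {G B : Type*} [Group G] [Fintype G] [DecidableEq G] [Ring B]
    (π : G → B) (X : Finset G) : B :=
  (X.toList.map fun r => π r * π r⁻¹).prod *
    (Xᶜ.toList.map fun s => 1 - π s * π s⁻¹).prod

/-- `Γ_X = Σ_{Y ∼ X} P_Y`, where `Y ∼ X` iff `Y = gX` for some `g ∈ G`. -/
noncomputable def parGamma {G B : Type*} [Group G] [Fintype G] [DecidableEq G] [Ring B]
    (π : G → B) (X : Finset G) : B :=
  ∑ Y ∈ Finset.univ.filter (fun Y : Finset G => ∃ g : G, Y = g • X), parP π Y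

namespace IsPartialRep

variable {G B : Type*} [Group G] [Monoid B] {π : G → B}

theorem eps_mul_self (hπ : IsPartialRep π) (g : G) : π g * π g⁻¹ * π g = π g := by
  simpa [hπ.1] using hπ.2.1 g g⁻¹

theorem mul_eq_eps_mul (hπ : IsPartialRep π) (g h : G) :
    π g * π h = π g * π g⁻¹ * π (g * h) := by
  conv_lhs => rw [← hπ.eps_mul_self g]
  simp only [mul_assoc, ← hπ.2.2 g h]

theorem mul_prod_eq_eps_prod (hπ : IsPartialRep π) (g : G) (L : List G) :
    π g * (L.map π).prod =
      π g * π g⁻¹ * ((List.range L.length).map fun i =>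
          π (g * (L.take (i + 1)).prod) * π (g * (L.take (i + 1)).prod)⁻¹).prod *
        π (g * L.prod) := by
  induction L generalizing g with
  | nil => simp [hπ.eps_mul_self]
  | cons h L ih =>
    rw [List.map_cons, List.prod_cons, ← mul_assoc, hπ.mul_eq_eps_mul, mul_assoc, ih,
      List.length_cons, List.range_succ_eq_map]
    simp [Function.comp_def, mul_assoc]

end IsPartialRep

/-- For a partial representation `π : G → B` with `ε_g := π(g)π(g⁻¹)`, and any nonempty
list `g_1, …, g_n` of elements of `G` (encoded as a nonempty `List G`),
`π(g_1)⋯π(g_n) = ε_{g_1} ε_{g_1g_2} ⋯ ε_{g_1⋯g_n} · π(g_1⋯g_n)`. -/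
theorem partialRep_prod_eq_eps_prod
    (k : Type*) [Field k] {G : Type*} [Group G]
    {B : Type*} [Ring B] [Algebra k B]
    (π : G → B) (hπ : IsPartialRep π) (L : List G) (hL : L ≠ []) :
    (L.map π).prod =
      ((List.range L.length).map fun i =>
          π (L.take (i + 1)).prod * π ((L.take (i + 1)).prod)⁻¹).prod *
        π L.prod := by
  simpa [hπ.1] using hπ.mul_prod_eq_eps_prod 1 L
end

section
/- Let G be a finite group and π : G → B a partial representation on a unital associative k-algebra B. Then: (1) for all subsets X, Y ⊆ G, P_X P_Y = P_X if X = Y and P_X P_Y = 0 otherwise; (2) P_X = 0 whenever e ∉ X; (3) the sum of P_X over all subsets X ⊆ G equals 1_B (equivalently, the sum of P_X over all X ⊆ G with e ∈ X equals 1_B). -/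
open scoped Pointwise

universe u

theorem IsPartialRep.mul_self_inv {G B : Type*} [Group G] [Monoid B] {π : G → B}
    (hπ : IsPartialRep π) (g h : G) :
    π g * (π h * π h⁻¹) = π (g * h) * π (g * h)⁻¹ * π g := by
  have h3 := hπ.2.2 (g * h)⁻¹ g
  rw [inv_inv, show (g * h)⁻¹ * g = h⁻¹ by group] at h3
  rw [← mul_assoc, hπ.2.1, h3]

theorem IsPartialRep.commute {G B : Type*} [Group G] [Monoid B] {π : G → B}
    (hπ : IsPartialRep π) (g h : G) :
    (π g * π g⁻¹) * (π h * π h⁻¹) = (π h * π h⁻¹) * (π g * π g⁻¹) := by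
  rw [mul_assoc, hπ.mul_self_inv g⁻¹ h, ← mul_assoc, hπ.mul_self_inv g (g⁻¹ * h),
    mul_inv_cancel_left, mul_assoc]

theorem IsPartialRep.idempotent {G B : Type*} [Group G] [Monoid B] {π : G → B}
    (hπ : IsPartialRep π) (g : G) :
    (π g * π g⁻¹) * (π g * π g⁻¹) = π g * π g⁻¹ := by
  have h3 := hπ.2.2 g⁻¹ g
  rw [inv_inv, inv_mul_cancel, hπ.1, mul_one] at h3
  rw [← mul_assoc, h3]

/-- In a commutative ring, the idempotents attached to subsets for a family of idempotents
are orthogonal. -/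
theorem prod_mul_prod_one_sub_orthogonal {ι R : Type*} [Fintype ι] [DecidableEq ι] [CommRing R]
    (e : ι → R) (he : ∀ i, e i * e i = e i) (X Y : Finset ι) :
    ((∏ i ∈ X, e i) * ∏ i ∈ Xᶜ, (1 - e i)) * ((∏ i ∈ Y, e i) * ∏ i ∈ Yᶜ, (1 - e i)) =
      if X = Y then (∏ i ∈ X, e i) * ∏ i ∈ Xᶜ, (1 - e i) else 0 := by
  have key (Z : Finset ι) : (∏ i ∈ Z, e i) * ∏ i ∈ Zᶜ, (1 - e i) =
      ∏ i, if i ∈ Z then e i else 1 - e i := by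
    rw [← Finset.prod_mul_prod_compl Z]
    congr 1 <;> refine Finset.prod_congr rfl fun i hi => ?_
    · rw [if_pos hi]
    · rw [if_neg (Finset.mem_compl.1 hi)]
  simp only [key, ← Finset.prod_mul_distrib]
  split_ifs with h
  · subst h
    refine Finset.prod_congr rfl fun i _ => ?_
    split_ifs
    · exact he i
    · linear_combination he i
  · obtain ⟨i, hi⟩ : ∃ i, ¬(i ∈ X ↔ i ∈ Y) := by
      by_contra! hc
      exact h (Finset.ext hc)
    refine Finset.prod_eq_zero (Finset.mem_univ i) ?_
    by_cases hX : i ∈ X <;> by_cases hY : i ∈ Y <;> simp only [hX, hY, if_true, if_false]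
    · exact absurd (iff_of_true hX hY) hi
    · linear_combination -he i
    · linear_combination -he i
    · exact absurd (iff_of_false hX hY) hi

/-- A family of pairwise commuting elements of a ring lifts to a commutative ring
embedded in it. -/
theorem exists_commRing_lift {ι : Type*} {B : Type u} [Ring B] (e : ι → B)
    (he : ∀ i j, e i * e j = e j * e i) :
    ∃ (R : Type u) (_ : CommRing R) (f : R →+* B) (a : ι → R),
      Function.Injective f ∧ ∀ i, f (a i) = e i := by
  have : IsMulCommutative (Subring.closure (Set.range e)) :=
    Subring.isMulCommutative_closure (by
      rintro _ ⟨i, rfl⟩ _ ⟨j, rfl⟩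
      exact he i j)
  exact ⟨Subring.closure (Set.range e), { mul_comm := mul_comm' }, (Subring.closure (Set.range e)).subtype,
    fun i => ⟨e i, Subring.subset_closure ⟨i, rfl⟩⟩, Subtype.val_injective, fun _ => rfl⟩

theorem parP_eq_map {G B R : Type*} [Group G] [Fintype G] [DecidableEq G] [Ring B] [CommRing R]
    (π : G → B) (f : R →+* B) (a : G → R) (ha : ∀ g, f (a g) = π g * π g⁻¹) (X : Finset G) :
    parP π X = f ((∏ g ∈ X, a g) * ∏ g ∈ Xᶜ, (1 - a g)) := by
  rw [parP, map_mul, ← Finset.prod_map_toList, ← Finset.prod_map_toList, map_list_prod,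
    map_list_prod, List.map_map, List.map_map]
  simp only [Function.comp_def, map_sub, map_one, ha]

/-- For a finite group `G` and a partial representation `π : G → B`:
(1) `P_X P_Y = P_X` if `X = Y` and `0` otherwise; (2) `P_X = 0` whenever `e ∉ X`;
(3) `Σ_{X ⊆ G} P_X = 1`, equivalently `Σ_{X ⊆ G, e ∈ X} P_X = 1`. -/
theorem parP_props
    (k : Type*) [Field k] {G : Type*} [Group G] [Fintype G] [DecidableEq G]
    {B : Type*} [Ring B] [Algebra k B]
    (π : G → B) (hπ : IsPartialRep π) :
    (∀ X Y : Finset G, parP π X * parP π Y = if X = Y then parP π X else 0) ∧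
    (∀ X : Finset G, (1 : G) ∉ X → parP π X = 0) ∧
    (∑ X : Finset G, parP π X = 1) ∧
    (∑ X ∈ Finset.univ.filter (fun X : Finset G => (1 : G) ∈ X), parP π X = 1) := by
  obtain ⟨R, _, f, a, hf, ha⟩ := exists_commRing_lift (fun g => π g * π g⁻¹) hπ.commute
  have hP := parP_eq_map π f a ha
  have ha_idem (g : G) : a g * a g = a g := hf (by simp only [map_mul, ha, hπ.idempotent])
  have zero (X : Finset G) (hX : (1 : G) ∉ X) : parP π X = 0 := by
    have h1 : a 1 = 1 := hf (by rw [ha, inv_one, hπ.1, mul_one, map_one])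
    rw [hP, Finset.prod_eq_zero (Finset.mem_compl.2 hX) (by rw [h1, sub_self]), mul_zero,
      map_zero]
  have sum_one : ∑ X : Finset G, parP π X = 1 := by
    have h := Finset.prod_add a (fun g => 1 - a g) Finset.univ
    simp only [add_sub_cancel, Finset.prod_const_one, Finset.powerset_univ,
      ← Finset.compl_eq_univ_sdiff] at h
    simp only [hP, ← map_sum, ← h, map_one]
  refine ⟨fun X Y => ?_, zero, sum_one, ?_⟩
  · rw [hP, hP, ← map_mul, prod_mul_prod_one_sub_orthogonal a ha_idem, apply_ite f, map_zero]
  · rw [← sum_one]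
    refine Finset.sum_filter_of_ne fun X _ hne => ?_
    by_contra hX
    exact hne (zero X hX)
end

section
/- Let G be a finite group and π : G → B a partial representation on a unital associative k-algebra B. Then for every g ∈ G and every subset X ⊆ G: π(g) P_X = P_{gX} π(g) if g⁻¹ ∈ X, and π(g) P_X = 0 if g⁻¹ ∉ X, where gX = {gh : h ∈ X}. -/
open scoped Pointwise

namespace IsPartialRep

variable {G B : Type*} [Group G]

theorem semiconjBy [Monoid B] {π : G → B} (hπ : IsPartialRep π) (g h : G) :
    SemiconjBy (π g) (π h * π h⁻¹) (π (g * h) * π (g * h)⁻¹) := by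
  have h3 := hπ.2.2 (g * h)⁻¹ g
  rw [inv_inv, show (g * h)⁻¹ * g = h⁻¹ by group] at h3
  rw [SemiconjBy, h3, ← mul_assoc, hπ.2.1]

theorem commute_s4 [Monoid B] {π : G → B} (hπ : IsPartialRep π) (g h : G) :
    Commute (π g * π g⁻¹) (π h * π h⁻¹) := by
  simpa [Commute] using (hπ.semiconjBy g (g⁻¹ * h)).mul_left (hπ.semiconjBy g⁻¹ h)

end IsPartialRep

theorem SemiconjBy.list_prod_map {ι M : Type*} [Monoid M] {a : M} {f f' : ι → M}
    (h : ∀ i, SemiconjBy a (f i) (f' i)) (l : List ι) :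
    SemiconjBy a (l.map f).prod (l.map f').prod := by
  induction l with
  | nil => simp
  | cons i l ih => simpa using (h i).mul_right ih

theorem Finset.prod_map_toList_smul {G M : Type*} [Group G] [DecidableEq G] [Monoid M]
    {f : G → M} (hf : ∀ a b, Commute (f a) (f b)) (g : G) (X : Finset G) :
    ((g • X).toList.map f).prod = (X.toList.map fun x => f (g * x)).prod := by
  have hperm : (g • X).toList.Perm (X.toList.map (g * ·)) := by
    refine List.perm_of_nodup_nodup_toFinset_eq (Finset.nodup_toList _)
      ((Finset.nodup_toList X).map (mul_right_injective g)) ?_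
    ext x
    simp [Finset.mem_smul_finset]
  rw [(hperm.map f).prod_eq' (List.pairwise_map.2 (List.pairwise_of_forall fun a b => hf a b)),
    List.map_map]
  rfl

theorem parP_smul_semiconjBy {G B : Type*} [Group G] [Fintype G] [DecidableEq G] [Ring B]
    {π : G → B} (hπ : IsPartialRep π) (g : G) (X : Finset G) :
    SemiconjBy (π g) (parP π X) (parP π (g • X)) := by
  have hcompl : (g • X)ᶜ = g • Xᶜ := by
    ext x
    simp [← Finset.inv_smul_mem_iff]
  rw [parP, parP, hcompl, Finset.prod_map_toList_smul hπ.commute_s4,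
    Finset.prod_map_toList_smul (f := fun s => 1 - π s * π s⁻¹) fun a b =>
      ((Commute.one_left _).sub_left ((Commute.one_right _).sub_right (hπ.commute_s4 a b)))]
  exact (SemiconjBy.list_prod_map (hπ.semiconjBy g) _).mul_right
    (SemiconjBy.list_prod_map
      (fun h => (SemiconjBy.one_right _).sub_right (hπ.semiconjBy g h)) _)

theorem parP_eq_zero_of_one_notMem {G B : Type*} [Group G] [Fintype G] [DecidableEq G] [Ring B]
    {π : G → B} (hπ : IsPartialRep π) {X : Finset G} (hX : 1 ∉ X) : parP π X = 0 := by
  have hprod : (Xᶜ.toList.map fun s => 1 - π s * π s⁻¹).prod = 0 :=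
    List.prod_eq_zero (List.mem_map.2 ⟨1, by simpa using hX, by simp [hπ.1]⟩)
  rw [parP, hprod, mul_zero]

/-- For a finite group `G`, a partial representation `π : G → B`, `g ∈ G` and `X ⊆ G`:
`π(g) P_X = P_{gX} π(g)` if `g⁻¹ ∈ X`, and `π(g) P_X = 0` otherwise. -/
theorem parP_commute
    (k : Type*) [Field k] {G : Type*} [Group G] [Fintype G] [DecidableEq G]
    {B : Type*} [Ring B] [Algebra k B]
    (π : G → B) (hπ : IsPartialRep π) (g : G) (X : Finset G) :
    π g * parP π X = if g⁻¹ ∈ X then parP π (g • X) * π g else 0 := by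
  rw [(parP_smul_semiconjBy hπ g X).eq]
  split_ifs with hg
  · rfl
  · have hX : (1 : G) ∉ g • X := by simpa [← Finset.inv_smul_mem_iff] using hg
    rw [parP_eq_zero_of_one_notMem hπ hX, zero_mul]
end

section
/- Simplicity of the modules M_{(X,α)}: let k be an algebraically closed field of characteristic zero, G a finite group, X ⊆ G a subset with e ∈ X, G_X = {g ∈ G : gX = X} its isotropy subgroup, and g_1, …, g_n ∈ G with g_i⁻¹ ∈ X such that X is the disjoint union of the cosets G_X g_i⁻¹. Let ρ : G_X → GL(V) be an irreducible finite-dimensional representation of G_X on a nonzero k-vector space V. Define φ : G → End_k(V^n) by (φ(g)(v_1, …, v_n))_i = Σ_{j : g_i⁻¹ g g_j ∈ G_X} ρ(g_i⁻¹ g g_j)(v_j). Then φ is a partial representation of G on End_k(V^n), and the only k-subspaces W ⊆ V^n satisfying φ(g)(W) ⊆ W for all g ∈ G are W = 0 and W = V^n. -/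
open scoped Pointwise

section CosetBlocks

variable {k : Type*} [Field k] {G : Type*} [Group G] {ι : Type*}
  {H : Subgroup G} {g : ι → G} {V : Type*} [AddCommGroup V] [Module k V]
  {ρ : Representation k H V}

/-- Distinct indices of `g` give distinct left cosets of `H`. -/
def SeparatesCosets (H : Subgroup G) (g : ι → G) : Prop :=
  ∀ i j, (g i)⁻¹ * g j ∈ H → i = j

theorem SeparatesCosets.eq_of_mul_eq (hg : SeparatesCosets H g) {x : G} {i j : ι} {s t : H}
    (hi : g i * s = x) (hj : g j * t = x) : i = j := by
  apply hg
  have : (g i)⁻¹ * g j = (s * t⁻¹ : H) := by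
    have h1 : g j = g i * s * (t : G)⁻¹ := by rw [hi, ← hj]; group
    rw [h1]; push_cast; group
  rw [this]
  exact SetLike.coe_mem _

variable [Fintype ι]

/-- `φ` is given by the block matrices `(ρ(g_i⁻¹ γ g_j))_{i,j}`, where `ρ` is extended by zero
outside of `H`. -/
def IsCosetBlockAction [DecidablePred (· ∈ H)] (g : ι → G) (ρ : Representation k H V)
    (φ : G → Module.End k (ι → V)) : Prop :=
  ∀ (γ : G) (v : ι → V) (i : ι),
    φ γ v i = ∑ j, if h : (g i)⁻¹ * γ * g j ∈ H then ρ ⟨(g i)⁻¹ * γ * g j, h⟩ (v j) else 0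

namespace IsCosetBlockAction

variable [DecidablePred (· ∈ H)] {φ : G → Module.End k (ι → V)}

theorem apply_eq (hφ : IsCosetBlockAction g ρ φ) (hg : SeparatesCosets H g) {γ : G} {i j : ι}
    {s : H} (h : g i * s = γ * g j) (v : ι → V) : φ γ v i = ρ s (v j) := by
  have hs : (g i)⁻¹ * γ * g j = s := by rw [mul_assoc, ← h]; group
  rw [hφ, Finset.sum_eq_single j]
  · have hm : (g i)⁻¹ * γ * g j ∈ H := hs ▸ s.2
    rw [dif_pos hm]
    congr 2
    exact Subtype.ext hs
  · intro l _ hl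
    refine dif_neg fun hm => hl ?_
    apply hg
    have : (g l)⁻¹ * g j = ((g i)⁻¹ * γ * g l)⁻¹ * ((g i)⁻¹ * γ * g j) := by group
    rw [this]
    exact H.mul_mem (H.inv_mem hm) (hs ▸ s.2)
  · simp

theorem apply_eq_zero (hφ : IsCosetBlockAction g ρ φ) {γ : G} {i : ι}
    (h : ¬ ∃ (j : ι) (s : H), g i * s = γ * g j) (v : ι → V) : φ γ v i = 0 := by
  rw [hφ]
  refine Finset.sum_eq_zero fun j _ => dif_neg fun hm => h ⟨j, ⟨_, hm⟩, ?_⟩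
  simp only
  group

theorem isPartialRep (hφ : IsCosetBlockAction g ρ φ) (hg : SeparatesCosets H g) :
    IsPartialRep φ := by
  refine ⟨?_, fun a b => ?_, fun a b => ?_⟩ <;> refine LinearMap.ext fun v => funext fun i => ?_
  · rw [hφ.apply_eq hg (s := 1) (j := i) (by simp)]
    simp
  · simp only [Module.End.mul_apply]
    by_cases hj : ∃ (j : ι) (s : H), g i * s = a * g j
    · obtain ⟨j, s, hs⟩ := hj
      rw [hφ.apply_eq hg hs]
      by_cases hq : ∃ (q : ι) (r : H), g j * r = b * g q
      · obtain ⟨q, r, hr⟩ := hq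
        have hsr : g i * (s * r : H) = a * b * g q := by
          rw [Subgroup.coe_mul, ← mul_assoc, hs, mul_assoc, hr, mul_assoc]
        rw [hφ.apply_eq hg hr, hφ.apply_eq hg hsr, map_mul, Module.End.mul_apply]
      · rw [hφ.apply_eq_zero hq, map_zero]
        by_cases hl : ∃ (l : ι) (t : H), g i * t = a * b * g l
        · obtain ⟨l, t, ht⟩ := hl
          rw [hφ.apply_eq hg ht, hφ.apply_eq_zero, map_zero]
          rintro ⟨m, u, hu⟩
          have hjm : j = m := by
            refine hg.eq_of_mul_eq (x := a⁻¹ * g i) (s := s⁻¹) (t := (t * u)⁻¹) ?_ ?_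
            · rw [Subgroup.coe_inv, mul_inv_eq_iff_eq_mul, mul_assoc, hs]; group
            · rw [Subgroup.coe_inv, mul_inv_eq_iff_eq_mul, Subgroup.coe_mul, mul_assoc,
                ← mul_assoc (g i), ht, mul_assoc, hu]
              group
          subst hjm
          refine hq ⟨l, u⁻¹, ?_⟩
          rw [Subgroup.coe_inv, mul_inv_eq_iff_eq_mul, mul_assoc, hu]
          group
        · rw [hφ.apply_eq_zero hl]
    · rw [hφ.apply_eq_zero hj]
      by_cases hl : ∃ (l : ι) (t : H), g i * t = a * b * g l
      · obtain ⟨l, t, ht⟩ := hl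
        rw [hφ.apply_eq hg ht, hφ.apply_eq_zero, map_zero]
        rintro ⟨m, u, hu⟩
        refine hj ⟨m, t * u, ?_⟩
        rw [Subgroup.coe_mul, ← mul_assoc, ht, mul_assoc, hu]
        group
      · rw [hφ.apply_eq_zero hl]
  · simp only [Module.End.mul_apply]
    by_cases hj : ∃ (j : ι) (s : H), g i * s = a⁻¹ * g j
    · obtain ⟨j, s, hs⟩ := hj
      have hs' : g j * (s⁻¹ : H) = a * g i := by
        rw [Subgroup.coe_inv, mul_inv_eq_iff_eq_mul, mul_assoc, hs]
        group
      rw [hφ.apply_eq hg hs, hφ.apply_eq hg hs, hφ.apply_eq hg hs']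
      congr 1
      by_cases hq : ∃ (q : ι) (r : H), g i * r = b * g q
      · obtain ⟨q, r, hr⟩ := hq
        have hsr : g j * (s⁻¹ * r : H) = a * b * g q := by
          rw [Subgroup.coe_mul, ← mul_assoc, hs', mul_assoc, hr, mul_assoc]
        rw [hφ.apply_eq hg hr, hφ.apply_eq hg hsr, map_mul, Module.End.mul_apply]
      · rw [hφ.apply_eq_zero hq, hφ.apply_eq_zero, map_zero]
        rintro ⟨l, t, ht⟩
        refine hq ⟨l, s * t, ?_⟩
        rw [Subgroup.coe_mul, ← mul_assoc, hs, mul_assoc, ht]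
        group
    · rw [hφ.apply_eq_zero hj, hφ.apply_eq_zero hj]

open scoped Classical in
/-- `φ γ * φ γ⁻¹` is the projection onto the coordinates `i` with `γ ∈ ⋃ j, g_i H g_j⁻¹`. -/
theorem apply_apply_inv (hφ : IsCosetBlockAction g ρ φ) (hg : SeparatesCosets H g) (γ : G)
    (v : ι → V) (i : ι) :
    φ γ (φ γ⁻¹ v) i = if ∃ j, (g i)⁻¹ * γ * g j ∈ H then v i else 0 := by
  split_ifs with h
  · obtain ⟨j, hj⟩ := h
    have hs : g i * (⟨_, hj⟩ : H) = γ * g j := by simp only; group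
    have hs' : g j * ((⟨_, hj⟩ : H)⁻¹ : H) = γ⁻¹ * g i := by
      rw [Subgroup.coe_inv, mul_inv_eq_iff_eq_mul, mul_assoc, hs]
      group
    rw [hφ.apply_eq hg hs, hφ.apply_eq hg hs', ← Module.End.mul_apply, ← map_mul,
      mul_inv_cancel, map_one, Module.End.one_apply]
  · rw [hφ.apply_eq_zero]
    rintro ⟨j, s, hs⟩
    refine h ⟨j, ?_⟩
    rw [mul_assoc, ← hs, inv_mul_cancel_left]
    exact s.2

theorem apply_single [DecidableEq ι] (hφ : IsCosetBlockAction g ρ φ) (hg : SeparatesCosets H g)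
    (i j : ι) (s : H) (u : V) :
    φ (g i * s * (g j)⁻¹) (Pi.single j u) = Pi.single i (ρ s u) := by
  funext l
  by_cases hl : l = i
  · subst hl
    rw [hφ.apply_eq hg (s := s) (j := j) (by group), Pi.single_eq_same, Pi.single_eq_same]
  · rw [Pi.single_eq_of_ne hl]
    by_cases h : ∃ (m : ι) (t : H), g l * t = g i * s * (g j)⁻¹ * g m
    · obtain ⟨m, t, ht⟩ := h
      rw [hφ.apply_eq hg ht, Pi.single_eq_of_ne, map_zero]
      rintro rfl
      exact hl (hg.eq_of_mul_eq ht (t := s) (by group))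
    · exact hφ.apply_eq_zero h _

open scoped Classical in
theorem restrict_mem (hφ : IsCosetBlockAction g ρ φ) (hg : SeparatesCosets H g)
    {W : Submodule k (ι → V)} (hW : ∀ v ∈ W, ∀ γ : G, φ γ v ∈ W) (S : Finset G) {v : ι → V}
    (hv : v ∈ W) :
    (fun i => if ∀ γ ∈ S, ∃ j, (g i)⁻¹ * γ * g j ∈ H then v i else 0) ∈ W := by
  induction S using Finset.induction_on with
  | empty => simpa using hv
  | insert a S _ ih =>
    convert hW _ (hW _ ih a⁻¹) a using 1
    funext i
    rw [hφ.apply_apply_inv hg]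
    simp only [Finset.forall_mem_insert, ite_and]

/-- An invariant subspace of a coset block action is trivial if `ρ` is irreducible and the sets
`⋃ a, g_i H g_a⁻¹` form an antichain. -/
theorem eq_bot_or_eq_top [Fintype G] (hφ : IsCosetBlockAction g ρ φ) (hg : SeparatesCosets H g)
    (hanti : ∀ i j, (∀ γ, (∃ a, (g i)⁻¹ * γ * g a ∈ H) → ∃ a, (g j)⁻¹ * γ * g a ∈ H) → i = j)
    (hirr : ∀ U : Submodule k V, (∀ v ∈ U, ∀ s : H, ρ s v ∈ U) → U = ⊥ ∨ U = ⊤)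
    {W : Submodule k (ι → V)} (hW : ∀ v ∈ W, ∀ γ : G, φ γ v ∈ W) : W = ⊥ ∨ W = ⊤ := by
  classical
  refine or_iff_not_imp_left.2 fun hne => ?_
  obtain ⟨v, hv, hv0⟩ := W.ne_bot_iff.1 hne
  obtain ⟨i, hi⟩ := Function.ne_iff.1 hv0
  have hsingle : Pi.single i (v i) ∈ W := by
    convert hφ.restrict_mem hg hW
      (Finset.univ.filter fun γ => ∃ a, (g i)⁻¹ * γ * g a ∈ H) hv using 1
    funext j
    by_cases hj : j = i
    · subst hj
      simp
    · rw [Pi.single_eq_of_ne hj, if_neg]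
      exact fun h => hj (hanti i j fun γ hγ => h γ (by simpa using hγ)).symm
  have htop : W.comap (LinearMap.single k (fun _ : ι => V) i) = ⊤ := by
    refine (hirr _ fun u hu s => ?_).resolve_left fun hbot => hi ?_
    · have := hW _ hu (g i * s * (g i)⁻¹)
      rwa [LinearMap.single_apply, hφ.apply_single hg] at this
    · have : v i ∈ W.comap (LinearMap.single k (fun _ : ι => V) i) := hsingle
      rwa [hbot, Submodule.mem_bot] at this
  refine eq_top_iff.2 fun w _ => ?_
  rw [← Finset.univ_sum_single w]
  refine W.sum_mem fun j _ => ?_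
  have hw : w j ∈ W.comap (LinearMap.single k (fun _ : ι => V) i) := htop ▸ Submodule.mem_top
  have := hW _ hw (g j * (1 : H) * (g i)⁻¹)
  rwa [LinearMap.single_apply, hφ.apply_single hg, map_one, Module.End.one_apply] at this

end IsCosetBlockAction

end CosetBlocks

/-- **Simplicity of the modules `M_{(X,α)}`.** Let `k` be an algebraically closed field
of characteristic zero, `G` a finite group, `X ⊆ G` with `e ∈ X`, `G_X` its isotropy
subgroup, and `g_1, …, g_n ∈ G` with `g_i⁻¹ ∈ X` such that `X` is the disjoint union of
the cosets `G_X g_i⁻¹`.  Let `ρ` be an irreducible finite-dimensional representation of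
`G_X` on a nonzero `k`-vector space `V`, and define `φ : G → End_k(V^n)` by
`(φ(g)v)_i = Σ_{j : g_i⁻¹ g g_j ∈ G_X} ρ(g_i⁻¹ g g_j)(v_j)`.  Then `φ` is a partial
representation of `G`, and the only subspaces `W ⊆ V^n` with `φ(g)(W) ⊆ W` for all `g`
are `0` and `V^n`. -/
theorem module_MXalpha_simple
    (k : Type*) [Field k] [IsAlgClosed k] [CharZero k]
    {G : Type*} [Group G] [Fintype G] [DecidableEq G]
    (X : Finset G) (heX : (1 : G) ∈ X) (n : ℕ) (g : Fin n → G)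
    (hginv : ∀ i, (g i)⁻¹ ∈ X)
    (hcover : ∀ x : G, x ∈ X ↔ ∃ i, x * g i ∈ MulAction.stabilizer G X)
    (hdisj : ∀ i j, (g i)⁻¹ * g j ∈ MulAction.stabilizer G X → i = j)
    (V : Type*) [AddCommGroup V] [Module k V] [FiniteDimensional k V] [Nontrivial V]
    (ρ : Representation k ↥(MulAction.stabilizer G X) V)
    (hirr : ∀ W : Submodule k V,
      (∀ v ∈ W, ∀ s : ↥(MulAction.stabilizer G X), ρ s v ∈ W) → W = ⊥ ∨ W = ⊤)
    (φ : G → Module.End k (Fin n → V))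
    (hφdef : ∀ (γ : G) (v : Fin n → V) (i : Fin n),
      φ γ v i =
        ∑ j : Fin n,
          if h : (g i)⁻¹ * γ * g j ∈ MulAction.stabilizer G X then
            ρ ⟨(g i)⁻¹ * γ * g j, h⟩ (v j)
          else 0) :
    IsPartialRep φ ∧
      ∀ W : Submodule k (Fin n → V),
        (∀ v ∈ W, ∀ γ : G, φ γ v ∈ W) → W = ⊥ ∨ W = ⊤ := by
  have hφ : IsCosetBlockAction g ρ φ := hφdef
  refine ⟨hφ.isPartialRep hdisj, fun W hW => hφ.eq_bot_or_eq_top hdisj (fun i j h => ?_) hirr hW⟩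
  simp only [← hcover] at h
  have hsub : g i • X ⊆ g j • X := fun γ hγ =>
    Finset.inv_smul_mem_iff.1 (h γ (Finset.inv_smul_mem_iff.2 hγ))
  have heq : g i • X = g j • X := Finset.eq_of_subset_of_card_le hsub (by simp)
  refine hdisj i j ?_
  rw [MulAction.mem_stabilizer_iff, mul_smul, ← heq, inv_smul_smul]
end

section
/- Classification of simple partial modules: let k be an algebraically closed field of characteristic zero and G a finite group. Then every simple left module M over the partial group algebra k_par G is isomorphic to one of the following form: there exist a subset X ⊆ G with e ∈ X, elements g_1, …, g_n ∈ G with g_i⁻¹ ∈ X such that X is the disjoint union of the cosets G_X g_i⁻¹ of the isotropy subgroup G_X = {g ∈ G : gX = X}, and an irreducible representation ρ : G_X → GL(V) of G_X on a finite-dimensional nonzero k-vector space V, such that M is isomorphic as a k_par G-module to V^n with action [g]·(v_1, …, v_n) having i-th component Σ_{j : g_i⁻¹ g g_j ∈ G_X} ρ(g_i⁻¹ g g_j)(v_j). -/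
open scoped Pointwise

universe u v w

namespace IsPartialRep

section Relations

variable {k G M : Type*} [Field k] [Group G] [AddCommGroup M] [Module k M]
  {T : G → Module.End k M}

lemma apply_one (hT : IsPartialRep T) (m : M) : T 1 m = m := by
  rw [hT.1]; rfl

lemma apply_apply_inv (hT : IsPartialRep T) (g h : G) (m : M) :
    T g (T h (T h⁻¹ m)) = T (g * h) (T h⁻¹ m) :=
  LinearMap.congr_fun (hT.2.1 g h) m

lemma inv_apply_apply (hT : IsPartialRep T) (g h : G) (m : M) :
    T g (T g⁻¹ (T h m)) = T g (T (g⁻¹ * h) m) := by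
  have := LinearMap.congr_fun (hT.2.2 g⁻¹ h) m
  rwa [inv_inv] at this

lemma apply_inv_apply (hT : IsPartialRep T) (g : G) (m : M) :
    T g (T g⁻¹ (T g m)) = T g m := by
  have := hT.inv_apply_apply g g m
  rwa [inv_mul_cancel, hT.apply_one] at this

/-- The generators intertwine the idempotents `T h * T h⁻¹`. -/
lemma apply_idem (hT : IsPartialRep T) (g h : G) (m : M) :
    T g (T h (T h⁻¹ m)) = T (g * h) (T (g * h)⁻¹ (T g m)) := by
  rw [hT.apply_apply_inv, hT.inv_apply_apply]
  simp [mul_assoc]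

lemma idem_comm (hT : IsPartialRep T) (g h : G) (m : M) :
    T g (T g⁻¹ (T h (T h⁻¹ m))) = T h (T h⁻¹ (T g (T g⁻¹ m))) := by
  rw [hT.apply_idem g⁻¹ h, hT.apply_idem g (g⁻¹ * h)]
  simp

end Relations

section Components

variable {k G M : Type*} [Field k] [Group G] [AddCommGroup M] [Module k M]

/-- The simultaneous eigenspace on which `T h * T h⁻¹` acts as `1` for `h ∈ X` and as `0`
for `h ∉ X`. -/
def component (T : G → Module.End k M) (X : Finset G) : Submodule k M where
  carrier := {m | ∀ h, (h ∈ X → T h (T h⁻¹ m) = m) ∧ (h ∉ X → T h (T h⁻¹ m) = 0)}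
  add_mem' ha hb h := by
    constructor <;> intro hh
    · simp [(ha h).1 hh, (hb h).1 hh]
    · simp [(ha h).2 hh, (hb h).2 hh]
  zero_mem' h := by simp
  smul_mem' c m hm h := by
    constructor <;> intro hh
    · simp [(hm h).1 hh]
    · simp [(hm h).2 hh]

variable {T : G → Module.End k M} {X : Finset G} {v : M}

lemma apply_mem_component [DecidableEq G] (hT : IsPartialRep T) (hv : v ∈ component T X)
    (g : G) : T g v ∈ component T (g • X) := by
  intro h
  have key : T h (T h⁻¹ (T g v)) = T g (T (g⁻¹ * h) (T (g⁻¹ * h)⁻¹ v)) := by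
    rw [hT.apply_idem g (g⁻¹ * h)]; simp
  have hmem : h ∈ g • X ↔ g⁻¹ * h ∈ X := by
    rw [← Finset.inv_smul_mem_iff, smul_eq_mul]
  rw [hmem, key]
  exact ⟨fun hh => by rw [(hv _).1 hh], fun hh => by rw [(hv _).2 hh, map_zero]⟩

lemma apply_eq_zero (hT : IsPartialRep T) (hv : v ∈ component T X) {g : G} (hg : g⁻¹ ∉ X) :
    T g v = 0 := by
  have := (hv g⁻¹).2 hg
  rw [inv_inv] at this
  rw [← hT.apply_inv_apply, this, map_zero]

lemma apply_apply (hT : IsPartialRep T) (hv : v ∈ component T X) (g : G) {h : G}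
    (hh : h⁻¹ ∈ X) : T g (T h v) = T (g * h) v := by
  have h1 := (hv h⁻¹).1 hh
  rw [inv_inv] at h1
  have := hT.apply_apply_inv g h (T h v)
  rwa [h1] at this

lemma one_mem_of_mem_component (hT : IsPartialRep T) (hv : v ∈ component T X) (h0 : v ≠ 0) :
    (1 : G) ∈ X := by
  by_contra h
  have := (hv 1).2 h
  rw [inv_one, hT.apply_one, hT.apply_one] at this
  exact h0 this

lemma exists_component_ne_bot [Fintype G] [DecidableEq G] [Nontrivial M]
    (hT : IsPartialRep T) : ∃ (X : Finset G) (v : M), v ∈ component T X ∧ v ≠ 0 := by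
  suffices H : ∀ S : Finset G, ∃ (X : Finset G) (v : M), v ≠ 0 ∧ ∀ h ∈ S,
      (h ∈ X → T h (T h⁻¹ v) = v) ∧ (h ∉ X → T h (T h⁻¹ v) = 0) by
    obtain ⟨X, v, h0, hv⟩ := H Finset.univ
    exact ⟨X, v, fun h => hv h (Finset.mem_univ h), h0⟩
  intro S
  induction S using Finset.induction_on with
  | empty =>
    obtain ⟨v, hv⟩ := exists_ne (0 : M)
    exact ⟨∅, v, hv, by simp⟩
  | insert a S ha ih =>
    obtain ⟨X, v, h0, hv⟩ := ih
    by_cases hav : T a (T a⁻¹ v) = 0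
    · refine ⟨X.erase a, v, h0, fun h hh => ?_⟩
      rcases eq_or_ne h a with rfl | hne
      · simp [hav]
      · simpa [hne] using hv h (Finset.mem_of_mem_insert_of_ne hh hne)
    · refine ⟨insert a X, T a (T a⁻¹ v), hav, fun h hh => ?_⟩
      rcases eq_or_ne h a with rfl | hne
      · simp [hT.apply_inv_apply]
      · have := hv h (Finset.mem_of_mem_insert_of_ne hh hne)
        simp only [Finset.mem_insert, hne, false_or]
        rw [hT.idem_comm]
        exact ⟨fun hX => by rw [this.1 hX], fun hX => by rw [this.2 hX, map_zero, map_zero]⟩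

/-- Components attached to distinct subsets are linearly independent. -/
lemma eq_zero_of_sum_component_eq_zero [Fintype G] [DecidableEq G]
    {ι : Type*} [Fintype ι] {Y : ι → Finset G} (hY : Function.Injective Y) {m : ι → M}
    (hm : ∀ i, m i ∈ component T (Y i)) (hsum : ∑ i, m i = 0) (i : ι) : m i = 0 := by
  classical
  suffices H : ∀ A : Finset G, ∑ j with (∀ a ∈ A, a ∈ Y j ↔ a ∈ Y i), m j = 0 by
    have := H Finset.univ
    rwa [show (Finset.univ.filter fun j => ∀ a ∈ Finset.univ, a ∈ Y j ↔ a ∈ Y i) = {i} by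
      ext j
      simp [← Finset.ext_iff, hY.eq_iff], Finset.sum_singleton] at this
  intro A
  induction A using Finset.induction_on with
  | empty => simpa using hsum
  | insert a A ha ih =>
    have h1 : ∑ j with (∀ a ∈ A, a ∈ Y j ↔ a ∈ Y i), (if a ∈ Y j then m j else 0) = 0 := by
      have := congrArg (fun x => T a (T a⁻¹ x)) ih
      simp only [map_sum, map_zero] at this
      refine (Finset.sum_congr rfl fun j _ => ?_).trans this
      split_ifs with h
      · exact ((hm j a).1 h).symm
      · exact ((hm j a).2 h).symm
    have h2 : ∑ j with (∀ a ∈ A, a ∈ Y j ↔ a ∈ Y i), (if a ∉ Y j then m j else 0) = 0 := by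
      have := sub_eq_zero.mpr (ih.trans h1.symm)
      rw [← Finset.sum_sub_distrib] at this
      refine (Finset.sum_congr rfl fun j _ => ?_).trans this
      by_cases h : a ∈ Y j <;> simp [h]
    simp only [Finset.forall_mem_insert, Finset.sum_filter] at h1 h2 ⊢
    by_cases hi : a ∈ Y i
    · refine (Finset.sum_congr rfl fun j _ => ?_).trans h1
      by_cases h : a ∈ Y j <;> simp [h, hi]
    · refine (Finset.sum_congr rfl fun j _ => ?_).trans h2
      by_cases h : a ∈ Y j <;> simp [h, hi]

/-- A nonzero component generates the whole module, provided there are no invariant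
submodules; hence the module is finite-dimensional. -/
lemma finiteDimensional [Finite G] (hT : IsPartialRep T)
    (hs : ∀ N : Submodule k M, (∀ g, ∀ m ∈ N, T g m ∈ N) → N = ⊥ ∨ N = ⊤)
    (hv : v ∈ component T X) (h0 : v ≠ 0) : FiniteDimensional k M := by
  have hinv : ∀ g, ∀ m ∈ Submodule.span k (Set.range fun h => T h v),
      T g m ∈ Submodule.span k (Set.range fun h => T h v) := by
    intro g m hm
    induction hm using Submodule.span_induction with
    | mem x hx =>
      obtain ⟨h, rfl⟩ := hx
      by_cases hh : h⁻¹ ∈ X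
      · rw [hT.apply_apply hv g hh]
        exact Submodule.subset_span ⟨g * h, rfl⟩
      · simp only [hT.apply_eq_zero hv hh, map_zero]
        exact Submodule.zero_mem _
    | zero => simp
    | add x y _ _ hx hy => rw [map_add]; exact Submodule.add_mem _ hx hy
    | smul c x _ hx => rw [map_smul]; exact Submodule.smul_mem _ c hx
  rcases hs _ hinv with h | h
  · refine absurd ?_ h0
    have : v ∈ Submodule.span k (Set.range fun h => T h v) :=
      Submodule.subset_span ⟨1, hT.apply_one v⟩
    rwa [h, Submodule.mem_bot] at this
  · exact ⟨h ▸ Submodule.fg_span (Set.finite_range _)⟩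

/-- The linear map from a power of the component of `X` determined by coset representatives. -/
def inducedMap (T : G → Module.End k M) (X : Finset G) {n : ℕ} (g : Fin n → G) :
    (Fin n → component T X) →ₗ[k] M :=
  ∑ j, T (g j) ∘ₗ (component T X).subtype ∘ₗ LinearMap.proj j

lemma inducedMap_apply {n : ℕ} (g : Fin n → G) (w : Fin n → component T X) :
    inducedMap T X g w = ∑ j, T (g j) (w j) := by
  simp [inducedMap]

end Components

section Isotropy

variable {k G M : Type*} [Field k] [Group G] [DecidableEq G] [AddCommGroup M] [Module k M]
  {T : G → Module.End k M} {X : Finset G}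

lemma mul_mem_of_mem_stabilizer {s x : G} (hs : s ∈ MulAction.stabilizer G X) :
    s * x ∈ X ↔ x ∈ X := by
  conv_lhs => rw [← MulAction.mem_stabilizer_iff.mp hs, ← smul_eq_mul,
    Finset.smul_mem_smul_finset_iff]

lemma inv_mem_of_mem_stabilizer (h1 : (1 : G) ∈ X) {s : G}
    (hs : s ∈ MulAction.stabilizer G X) : s⁻¹ ∈ X := by
  simpa using (mul_mem_of_mem_stabilizer (x := 1) (inv_mem hs)).mpr h1

/-- The representation of the isotropy subgroup of `X` on the component of `X`. -/
def isotropyRep (hT : IsPartialRep T) (h1 : (1 : G) ∈ X) :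
    Representation k (MulAction.stabilizer G X) (component T X) where
  toFun s := (T s).restrict fun v hv => by
    have := hT.apply_mem_component hv s
    rwa [MulAction.mem_stabilizer_iff.mp s.2] at this
  map_one' := by
    ext v
    exact hT.apply_one v.1
  map_mul' s t := by
    ext v
    exact (hT.apply_apply v.2 s (inv_mem_of_mem_stabilizer h1 t.2)).symm

lemma isotropyRep_apply_coe (hT : IsPartialRep T) (h1 : (1 : G) ∈ X)
    (s : MulAction.stabilizer G X) (v : component T X) :
    (isotropyRep hT h1 s v : M) = T s v := rfl

/-- A subset is the disjoint union of finitely many right cosets of its isotropy subgroup. -/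
lemma exists_coset_representatives [Finite G] (X : Finset G) :
    ∃ (n : ℕ) (g : Fin n → G), (∀ i, (g i)⁻¹ ∈ X) ∧
      (∀ x : G, x ∈ X ↔ ∃ i, x * g i ∈ MulAction.stabilizer G X) ∧
      (∀ i j, (g i)⁻¹ * g j ∈ MulAction.stabilizer G X → i = j) := by
  let φ := Finite.equivFin {q : G ⧸ MulAction.stabilizer G X // q.out⁻¹ ∈ X}
  have hg : ∀ i, ((φ.symm i).1.out)⁻¹ ∈ X := fun i => (φ.symm i).2
  refine ⟨_, fun i => (φ.symm i).1.out, hg, fun x => ⟨fun hx => ?_, ?_⟩, fun i j hij => ?_⟩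
  · let q : G ⧸ MulAction.stabilizer G X := QuotientGroup.mk x⁻¹
    have hq : x * q.out ∈ MulAction.stabilizer G X := by
      have : (QuotientGroup.mk x⁻¹ : G ⧸ MulAction.stabilizer G X) = QuotientGroup.mk q.out :=
        (QuotientGroup.out_eq' q).symm
      simpa using QuotientGroup.eq.mp this
    have hqX : q.out⁻¹ ∈ X := by
      rw [← mul_mem_of_mem_stabilizer hq]
      simpa using hx
    refine ⟨φ ⟨q, hqX⟩, ?_⟩
    simpa using hq
  · rintro ⟨i, hi⟩
    have := (mul_mem_of_mem_stabilizer hi).mpr (hg i)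
    simpa using this
  · apply φ.symm.injective
    apply Subtype.ext
    rw [← QuotientGroup.out_eq' (φ.symm i).1, ← QuotientGroup.out_eq' (φ.symm j).1]
    exact QuotientGroup.eq.mpr hij

variable {n : ℕ} {g : Fin n → G}

lemma inducedMap_injective [Fintype G] (hT : IsPartialRep T) (hg : ∀ i, (g i)⁻¹ ∈ X)
    (hinj : ∀ i j, (g i)⁻¹ * g j ∈ MulAction.stabilizer G X → i = j) :
    Function.Injective (inducedMap T X g) := by
  rw [injective_iff_map_eq_zero]
  intro w hw
  rw [inducedMap_apply] at hw
  have hY : Function.Injective fun i => g i • X := by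
    intro i j hij
    refine hinj i j (MulAction.mem_stabilizer_iff.mpr ?_)
    rw [mul_smul, ← show g i • X = g j • X from hij, inv_smul_smul]
  have h0 := eq_zero_of_sum_component_eq_zero hY
    (fun i => hT.apply_mem_component (w i).2 (g i)) hw
  ext i
  have := (w i).2 (g i)⁻¹
  rw [inv_inv] at this
  rw [← this.1 (hg i), h0 i, map_zero]
  rfl

lemma apply_inducedMap (hT : IsPartialRep T) (h1 : (1 : G) ∈ X) (hg : ∀ i, (g i)⁻¹ ∈ X)
    (hX : ∀ x : G, x ∈ X ↔ ∃ i, x * g i ∈ MulAction.stabilizer G X)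
    (hinj : ∀ i j, (g i)⁻¹ * g j ∈ MulAction.stabilizer G X → i = j)
    (γ : G) (w : Fin n → component T X) :
    T γ (inducedMap T X g w) = inducedMap T X g fun i => ∑ j : Fin n,
      if h : (g i)⁻¹ * γ * g j ∈ MulAction.stabilizer G X then
        isotropyRep hT h1 ⟨(g i)⁻¹ * γ * g j, h⟩ (w j) else 0 := by
  simp only [inducedMap_apply, Submodule.coe_sum, map_sum]
  rw [Finset.sum_comm]
  refine Finset.sum_congr rfl fun j _ => ?_
  rw [hT.apply_apply (w j).2 γ (hg j)]
  have hterm : ∀ i, T (g i) ((if h : (g i)⁻¹ * γ * g j ∈ MulAction.stabilizer G X then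
      isotropyRep hT h1 ⟨(g i)⁻¹ * γ * g j, h⟩ (w j) else 0 : component T X) : M) =
      if (g i)⁻¹ * γ * g j ∈ MulAction.stabilizer G X then T (γ * g j) (w j) else 0 := by
    intro i
    split_ifs with h
    · rw [isotropyRep_apply_coe, hT.apply_apply (w j).2 _ (inv_mem_of_mem_stabilizer h1 h)]
      simp [mul_assoc]
    · simp
  simp only [hterm]
  by_cases hγ : (γ * g j)⁻¹ ∈ X
  · obtain ⟨i, hi⟩ := (hX _).mp hγ
    have hi' : (g i)⁻¹ * γ * g j ∈ MulAction.stabilizer G X := by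
      simpa [mul_assoc] using inv_mem hi
    rw [Finset.sum_eq_single i, if_pos hi']
    · intro l _ hl
      refine if_neg fun hl' => hl (hinj l i ?_)
      simpa [mul_assoc] using mul_mem hl' (inv_mem hi')
    · simp
  · rw [hT.apply_eq_zero (w j).2 hγ]
    simp

/-- A nonzero module without proper invariant submodules under a partial representation is
induced from an irreducible representation of an isotropy subgroup. -/
theorem exists_induced [Fintype G] [Nontrivial M] (hT : IsPartialRep T)
    (hs : ∀ N : Submodule k M, (∀ g, ∀ m ∈ N, T g m ∈ N) → N = ⊥ ∨ N = ⊤) :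
    ∃ (X : Finset G), (1 : G) ∈ X ∧
      ∃ (n : ℕ) (g : Fin n → G),
        (∀ i, (g i)⁻¹ ∈ X) ∧
        (∀ x : G, x ∈ X ↔ ∃ i, x * g i ∈ MulAction.stabilizer G X) ∧
        (∀ i j, (g i)⁻¹ * g j ∈ MulAction.stabilizer G X → i = j) ∧
        ∃ V : Submodule k M,
          FiniteDimensional k V ∧ Nontrivial V ∧
          ∃ ρ : Representation k ↥(MulAction.stabilizer G X) V,
            (∀ W : Submodule k V,
              (∀ v ∈ W, ∀ s : ↥(MulAction.stabilizer G X), ρ s v ∈ W) →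
                W = ⊥ ∨ W = ⊤) ∧
            ∃ e : M ≃ₗ[k] (Fin n → V),
              ∀ (γ : G) (m : M) (i : Fin n),
                e (T γ m) i =
                  ∑ j : Fin n,
                    if h : (g i)⁻¹ * γ * g j ∈ MulAction.stabilizer G X then
                      ρ ⟨(g i)⁻¹ * γ * g j, h⟩ (e m j)
                    else 0 := by
  obtain ⟨X, v, hv, hv0⟩ := hT.exists_component_ne_bot
  have h1 := hT.one_mem_of_mem_component hv hv0
  have hfin : FiniteDimensional k M := hT.finiteDimensional hs hv hv0
  obtain ⟨n, g, hg, hX, hinj⟩ := exists_coset_representatives X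
  have hV : Nontrivial (component T X) :=
    ⟨⟨v, hv⟩, 0, fun h => hv0 (congrArg Subtype.val h)⟩
  obtain ⟨i₀, -⟩ := (hX 1).mp h1
  have hfi := inducedMap_injective hT hg hinj
  have heq := apply_inducedMap hT h1 hg hX hinj
  have hfs : Function.Surjective (inducedMap T X g) := by
    rw [← LinearMap.range_eq_top]
    refine (hs _ ?_).resolve_left fun hbot => ?_
    · rintro γ _ ⟨w, rfl⟩
      exact ⟨_, (heq γ w).symm⟩
    · have hw : inducedMap T X g (fun _ => ⟨v, hv⟩) ∈ LinearMap.range (inducedMap T X g) :=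
        ⟨_, rfl⟩
      rw [hbot, Submodule.mem_bot, ← map_zero (inducedMap T X g)] at hw
      exact hv0 (congrArg Subtype.val (congrFun (hfi hw) i₀))
  let e := (LinearEquiv.ofBijective (inducedMap T X g) ⟨hfi, hfs⟩).symm
  have he : ∀ w, e (inducedMap T X g w) = w := fun w =>
    LinearEquiv.ofBijective_symm_apply_apply _ w
  have hformula : ∀ (γ : G) (m : M) (i : Fin n), e (T γ m) i = ∑ j : Fin n,
      if h : (g i)⁻¹ * γ * g j ∈ MulAction.stabilizer G X then
        isotropyRep hT h1 ⟨(g i)⁻¹ * γ * g j, h⟩ (e m j) else 0 := by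
    intro γ m i
    obtain ⟨w, rfl⟩ := hfs m
    rw [heq, he, he]
  refine ⟨X, h1, n, g, hg, hX, hinj, component T X, inferInstance, hV, isotropyRep hT h1,
    fun W hW => ?_, e, hformula⟩
  have hN := hs ((Submodule.pi Set.univ fun _ => W).comap e.toLinearMap) fun γ m hm i _ => by
    refine (hformula γ m i).symm ▸ Submodule.sum_mem _ fun j _ => ?_
    split_ifs with h
    · exact hW _ (hm j (Set.mem_univ j)) _
    · exact W.zero_mem
  refine hN.imp (fun hbot => (Submodule.eq_bot_iff _).mpr fun x hx => ?_)
    fun htop => Submodule.eq_top_iff'.mpr fun x => ?_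
  · have hm : inducedMap T X g (fun _ => x) ∈
        (Submodule.pi Set.univ fun _ => W).comap e.toLinearMap := by
      intro i _
      simpa [he] using hx
    rw [hbot, Submodule.mem_bot, ← map_zero (inducedMap T X g)] at hm
    exact congrFun (hfi hm) i₀
  · have hm : inducedMap T X g (fun _ => x) ∈
        (Submodule.pi Set.univ fun _ => W).comap e.toLinearMap := htop ▸ Submodule.mem_top
    simpa [he] using hm i₀ (Set.mem_univ _)

end Isotropy

end IsPartialRep

lemma isPartialRep_parGen (k G : Type*) [CommSemiring k] [Group G] :
    IsPartialRep (parGen k : G → ParAlg k G) := by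
  refine ⟨?_, fun g h => ?_, fun g h => ?_⟩
  · simpa [parGen] using RingQuot.mkAlgHom_rel k (ParRel.one (k := k) (G := G))
  · simpa [parGen] using RingQuot.mkAlgHom_rel k (ParRel.pr2 (k := k) g h)
  · simpa [parGen] using RingQuot.mkAlgHom_rel k (ParRel.pr3 (k := k) g h)

lemma IsPartialRep.map {G A B F : Type*} [Group G] [Monoid A] [Monoid B] [FunLike F A B]
    [MonoidHomClass F A B] {π : G → A} (hπ : IsPartialRep π) (f : F) :
    IsPartialRep fun g => f (π g) := by
  refine ⟨by simp [hπ.1], fun g h => ?_, fun g h => ?_⟩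
  · simp only [← map_mul, hπ.2.1]
  · simp only [← map_mul, hπ.2.2]

/-- The partial group algebra is generated by the elements `[g]`. -/
lemma ParAlg.induction {k G : Type*} [CommSemiring k] [Group G] {p : ParAlg k G → Prop}
    (algebraMap : ∀ c : k, p (algebraMap k (ParAlg k G) c)) (gen : ∀ g : G, p (parGen k g))
    (mul : ∀ a b, p a → p b → p (a * b)) (add : ∀ a b, p a → p b → p (a + b))
    (a : ParAlg k G) : p a := by
  obtain ⟨a, rfl⟩ := RingQuot.mkAlgHom_surjective k (ParRel k G) a
  induction a using FreeAlgebra.induction with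
  | grade0 r => rw [AlgHom.commutes]; exact algebraMap r
  | grade1 x => exact gen x
  | mul a b ha hb => rw [map_mul]; exact mul _ _ ha hb
  | add a b ha hb => rw [map_add]; exact add _ _ ha hb

/-- **Classification of simple partial modules.** Over an algebraically closed field of
characteristic zero, every simple left `k_par G`-module `M` arises as follows: there are
a subset `X ⊆ G` with `e ∈ X`, elements `g_1, …, g_n` with `g_i⁻¹ ∈ X` decomposing `X`
as the disjoint union of the cosets `G_X g_i⁻¹` of the isotropy subgroup `G_X`, and an
irreducible representation `ρ` of `G_X` on a nonzero finite-dimensional `k`-vector space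
`V`, such that `M ≅ V^n` with `[g]` acting by
`([g]·v)_i = Σ_{j : g_i⁻¹ g g_j ∈ G_X} ρ(g_i⁻¹ g g_j)(v_j)`. -/
theorem simple_parAlg_module_classification
    (k : Type u) [Field k] [IsAlgClosed k] [CharZero k]
    (G : Type v) [Group G] [Fintype G] [DecidableEq G]
    (M : Type w) [AddCommGroup M] [Module (ParAlg k G) M]
    [IsSimpleModule (ParAlg k G) M] :
    ∃ (X : Finset G), (1 : G) ∈ X ∧
      ∃ (n : ℕ) (g : Fin n → G),
        (∀ i, (g i)⁻¹ ∈ X) ∧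
        (∀ x : G, x ∈ X ↔ ∃ i, x * g i ∈ MulAction.stabilizer G X) ∧
        (∀ i j, (g i)⁻¹ * g j ∈ MulAction.stabilizer G X → i = j) ∧
        ∃ V : ModuleCat.{w} k,
          FiniteDimensional k V ∧ Nontrivial V ∧
          ∃ ρ : Representation k ↥(MulAction.stabilizer G X) V,
            (∀ W : Submodule k V,
              (∀ v ∈ W, ∀ s : ↥(MulAction.stabilizer G X), ρ s v ∈ W) →
                W = ⊥ ∨ W = ⊤) ∧
            ∃ e : M ≃+ (Fin n → V),
              (∀ (c : k) (m : M),
                e (algebraMap k (ParAlg k G) c • m) = c • e m) ∧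
              (∀ (γ : G) (m : M) (i : Fin n),
                e (parGen k γ • m) i =
                  ∑ j : Fin n,
                    if h : (g i)⁻¹ * γ * g j ∈ MulAction.stabilizer G X then
                      ρ ⟨(g i)⁻¹ * γ * g j, h⟩ (e m j)
                    else 0) := by
  let _ : Module k M := Module.compHom M (algebraMap k (ParAlg k G))
  have : IsScalarTower k (ParAlg k G) M := IsScalarTower.of_algebraMap_smul fun _ _ => rfl
  have : Nontrivial M := IsSimpleModule.nontrivial (ParAlg k G) M
  have hT := (isPartialRep_parGen k G).map (Algebra.lsmul k k M)
  obtain ⟨X, h1, n, g, hg, hX, hinj, V, hVfin, hVnt, ρ, hρ, e, he⟩ :=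
    hT.exists_induced fun N hN => by
      let N' : Submodule (ParAlg k G) M :=
        { N with
          smul_mem' := fun a => by
            induction a using ParAlg.induction with
            | algebraMap c => exact @fun m hm => N.smul_mem c hm
            | gen g => exact @fun m hm => hN g m hm
            | mul a b ha hb => exact @fun m hm => mul_smul a b m ▸ ha (hb hm)
            | add a b ha hb => exact @fun m hm => add_smul a b m ▸ N.add_mem (ha hm) (hb hm) }
      have hmem : ∀ m, m ∈ N' ↔ m ∈ N := fun _ => Iff.rfl
      refine (eq_bot_or_eq_top N').imp (fun h => ?_) fun h => ?_
      · ext m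
        rw [← hmem, h, Submodule.mem_bot, Submodule.mem_bot]
      · ext m
        rw [← hmem, h]
        simp
  exact ⟨X, h1, n, g, hg, hX, hinj, ModuleCat.of k V, hVfin, hVnt, ρ, hρ, e.toAddEquiv,
    fun c m => e.map_smul c m, he⟩
end

section
/- Christmas Tree's Theorem (non-monoidal part): let k be an algebraically closed field of characteristic zero, G a finite group, and H ≤ G a subgroup. Then there exists a k-linear functor F from the category of left modules over the group algebra k[H] to the category of left modules over the partial group algebra k_par G such that: (1) F is additive; (2) F is faithful; (3) F is injective on objects; (4) for every k[H]-module V, the underlying k-vector space of F(V) is V and the generator [g] ∈ k_par G acts on F(V) as multiplication by g when g ∈ H and as the zero map when g ∉ H. -/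
open scoped Pointwise

universe u

open CategoryTheory

/-- The partial representation of `G` on `k[H]` extending the inclusion of `H` by zero. -/
noncomputable def extendByZero (k : Type*) {G : Type*} [CommSemiring k] [Group G]
    (H : Subgroup G) [DecidablePred (· ∈ H)] (g : G) : MonoidAlgebra k H :=
  if h : g ∈ H then MonoidAlgebra.of k H ⟨g, h⟩ else 0

theorem isPartialRep_extendByZero (k : Type*) {G : Type*} [CommSemiring k] [Group G]
    (H : Subgroup G) [DecidablePred (· ∈ H)] : IsPartialRep (extendByZero k H) := by
  refine ⟨?_, fun g h => ?_, fun g h => ?_⟩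
  · rw [extendByZero, dif_pos H.one_mem]
    exact map_one (MonoidAlgebra.of k H)
  · by_cases hh : h ∈ H
    · by_cases hg : g ∈ H
      · simp [extendByZero, hh, hg, H.mul_mem hg hh]
      · simp [extendByZero, hh, hg, H.mul_mem_cancel_right hh]
    · simp [extendByZero, hh]
  · by_cases hg : g ∈ H
    · by_cases hh : h ∈ H
      · simp [extendByZero, hh, hg, H.mul_mem hg hh]
      · simp [extendByZero, hh, hg, H.mul_mem_cancel_left hg]
    · simp [extendByZero, hg]

/-- The algebra map `k_par G → B` induced by a partial representation of `G` on `B`. -/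
noncomputable def IsPartialRep.lift (k : Type*) {G B : Type*} [CommSemiring k] [Group G]
    [Semiring B] [Algebra k B] {π : G → B} (hπ : IsPartialRep π) : ParAlg k G →ₐ[k] B :=
  RingQuot.liftAlgHom k ⟨FreeAlgebra.lift k π, by
    rintro _ _ (_ | ⟨g, h⟩ | ⟨g, h⟩)
    · simpa using hπ.1
    · simpa using hπ.2.1 g h
    · simpa using hπ.2.2 g h⟩

@[simp]
theorem IsPartialRep.lift_parGen (k : Type*) {G B : Type*} [CommSemiring k] [Group G]
    [Semiring B] [Algebra k B] {π : G → B} (hπ : IsPartialRep π) (g : G) :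
    hπ.lift k (parGen k g) = π g := by
  simp [IsPartialRep.lift, parGen]

theorem surjective_lift_extendByZero (k : Type*) {G : Type*} [CommSemiring k] [Group G]
    (H : Subgroup G) [DecidablePred (· ∈ H)] :
    Function.Surjective ((isPartialRep_extendByZero k H).lift k) := by
  intro x
  induction x using MonoidAlgebra.induction_on with
  | of h => exact ⟨parGen k (h : G), by simp [extendByZero]⟩
  | add x y hx hy =>
    obtain ⟨a, rfl⟩ := hx
    obtain ⟨b, rfl⟩ := hy
    exact ⟨a + b, map_add _ a b⟩
  | smul c x hx =>
    obtain ⟨a, rfl⟩ := hx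
    exact ⟨c • a, map_smul _ c a⟩

theorem ModuleCat.restrictScalars_obj_injective {R S : Type*} [Ring R] [Ring S] (f : R →+* S)
    (hf : Function.Surjective f) :
    Function.Injective (ModuleCat.restrictScalars.{u} f).obj := by
  rintro ⟨V⟩ ⟨W⟩ h
  injection h with hVW hadd hmod
  subst hVW
  obtain rfl := eq_of_heq hadd
  congr 1
  refine Module.ext' _ _ fun s x => ?_
  obtain ⟨r, rfl⟩ := hf s
  exact congrArg (fun m : Module R V => m.smul r x) (eq_of_heq hmod)

/-- **Christmas Tree's Theorem (non-monoidal part).** Let `k` be an algebraically closed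
field of characteristic zero, `G` a finite group, and `H ≤ G` a subgroup.  Then there is
a `k`-linear functor `F` from left `k[H]`-modules to left `k_par G`-modules which is
additive, faithful, injective on objects, and such that for every `k[H]`-module `V` the
underlying `k`-vector space of `F(V)` is `V` (via a `k`-compatible additive bijection),
with the generator `[g]` acting as multiplication by `g` when `g ∈ H` and as zero when
`g ∉ H`. -/
theorem christmas_tree
    (k : Type u) [Field k] [IsAlgClosed k] [CharZero k]
    (G : Type u) [Group G] [Fintype G] (H : Subgroup G) [DecidablePred (· ∈ H)] :
    ∃ F : ModuleCat.{u} (MonoidAlgebra k ↥H) ⥤ ModuleCat.{u} (ParAlg k G),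
      F.Additive ∧
      F.Faithful ∧
      Function.Injective F.obj ∧
      (∀ (V W : ModuleCat.{u} (MonoidAlgebra k ↥H)) (f : V ⟶ W) (c : k),
        F.map (c • f) = c • F.map f) ∧
      (∀ V : ModuleCat.{u} (MonoidAlgebra k ↥H),
        ∃ e : (F.obj V) ≃+ V,
          (∀ (c : k) (x : F.obj V),
            e (algebraMap k (ParAlg k G) c • x) =
              algebraMap k (MonoidAlgebra k ↥H) c • e x) ∧
          (∀ (g : G) (x : F.obj V),
            e (parGen k g • x) =
              if h : g ∈ H then
                (MonoidAlgebra.of k ↥H ⟨g, h⟩ : MonoidAlgebra k ↥H) • e x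
              else 0)) := by
  let φ := (isPartialRep_extendByZero k H).lift k
  refine ⟨ModuleCat.restrictScalars φ.toRingHom, inferInstance, inferInstance,
    ModuleCat.restrictScalars_obj_injective _ (surjective_lift_extendByZero k H), ?_, ?_⟩
  · intro V W f c
    ext x
    change algebraMap k (MonoidAlgebra k H) c • f.hom x =
      φ (algebraMap k (ParAlg k G) c) • f.hom x
    rw [φ.commutes]
  · intro V
    refine ⟨AddEquiv.refl V, fun c x => ?_, fun g x => ?_⟩
    · change φ (algebraMap k (ParAlg k G) c) • (show V from x) = _
      rw [φ.commutes]
      rfl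
    · change φ (parGen k g) • (show V from x) = _
      rw [IsPartialRep.lift_parGen, extendByZero]
      split_ifs
      · rfl
      · exact zero_smul _ _
end
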